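/- Under the smoothness and convexity assumptions (with f(x,·) merely convex and F(x,·) σ_F-strongly convex), for all μ, μ' with 0 < μ ≤ 1/2 and 0 < μ' ≤ 2μ, and every x ∈ ℝⁿ: ‖v*_μ(x) − v*_{μ'}(x)‖ ≤ (C_{v1} ‖v*_μ(x)‖ + C_{v2}) ‖∇_y F(x, y*_μ(x))‖ · |μ − μ'| / μ'², where C_{v1} := 2(L_{Fyy2} + L_{fyy2}) / σ_F² and C_{v2} := 2(2L_{Fy2} + L_{fy2}) / σ_F². -/

import Mathlib

open Set Filter Asymptotics
open scoped NNReal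

noncomputable section

/-- `ℝⁿ` as a Euclidean space. -/
abbrev Eu (n : ℕ) : Type := EuclideanSpace ℝ (Fin n)

variable {n m : ℕ}

/-- Partial gradient with respect to the first (upper-level) variable. -/
def gradx (F : Eu n → Eu m → ℝ) (x : Eu n) (y : Eu m) : Eu n :=
  gradient (fun x' => F x' y) x

/-- Partial gradient with respect to the second (lower-level) variable. -/
def grady (F : Eu n → Eu m → ℝ) (x : Eu n) (y : Eu m) : Eu m :=
  gradient (fun y' => F x y') y

/-- Second-order partial derivative `∇²_{yy}`. -/
def hessyy (F : Eu n → Eu m → ℝ) (x : Eu n) (y : Eu m) : Eu m →L[ℝ] Eu m :=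
  fderiv ℝ (fun y' => grady F x y') y

/-- Mixed second-order partial derivative `∇²_{xy}`, viewed as the linear map
sending a multiplier `v ∈ ℝᵐ` to an element of `ℝⁿ`. -/
def hessxy (F : Eu n → Eu m → ℝ) (x : Eu n) (y : Eu m) : Eu m →L[ℝ] Eu n :=
  ContinuousLinearMap.adjoint (fderiv ℝ (fun x' => grady F x' y) x)

/-- The aggregation function `ψ_μ = μ F + (1-μ) f`. -/
def aggreg (μ : ℝ) (F f : Eu n → Eu m → ℝ) : Eu n → Eu m → ℝ :=
  fun x y => μ * F x y + (1 - μ) * f x y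

/-- The squared KKT residual of the equality-constrained reformulation
`min F(x,y) s.t. ∇_y f(x,y) = 0`. -/
def KKTres (F f : Eu n → Eu m → ℝ) (x : Eu n) (y v : Eu m) : ℝ :=
  ‖gradx F x y - hessxy f x y v‖ ^ 2 + ‖grady F x y - hessyy f x y v‖ ^ 2 +
    ‖grady f x y‖ ^ 2

section MonotoneGradient

variable {E : Type*} [NormedAddCommGroup E] [InnerProductSpace ℝ E]

/-- The gradient of a differentiable convex function is a monotone operator. -/
theorem ConvexOn.inner_gradient_sub_nonneg [CompleteSpace E] {g : E → ℝ}
    (hg : ConvexOn ℝ univ g) (hd : Differentiable ℝ g) (a b : E) :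
    0 ≤ inner ℝ (gradient g a - gradient g b) (a - b) := by
  have hderiv (t : ℝ) : HasDerivAt (g ∘ AffineMap.lineMap (k := ℝ) b a)
      (inner ℝ (gradient g (AffineMap.lineMap b a t)) (a - b)) t := by
    rw [inner_gradient_left]
    exact (hd _).hasFDerivAt.comp_hasDerivAt t AffineMap.hasDerivAt_lineMap
  have hconv : ConvexOn ℝ univ (g ∘ AffineMap.lineMap (k := ℝ) b a) :=
    hg.comp_affineMap (AffineMap.lineMap b a)
  have hmono := hconv.monotoneOn_deriv (fun t _ => (hderiv t).differentiableAt)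
    (mem_univ 0) (mem_univ 1) zero_le_one
  rw [(hderiv 0).deriv, (hderiv 1).deriv, AffineMap.lineMap_apply_zero,
    AffineMap.lineMap_apply_one] at hmono
  rw [inner_sub_left]
  linarith

/-- The gradient of a differentiable strongly convex function is a strongly monotone operator. -/
theorem StrongConvexOn.le_inner_gradient_sub [CompleteSpace E] {g : E → ℝ} {σ : ℝ}
    (hg : StrongConvexOn univ σ g) (hd : Differentiable ℝ g) (a b : E) :
    σ * ‖a - b‖ ^ 2 ≤ inner ℝ (gradient g a - gradient g b) (a - b) := by
  have hgrad (y : E) : HasGradientAt (fun y => g y - σ / 2 * ‖y‖ ^ 2)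
      (gradient g y - σ • y) y := by
    rw [hasGradientAt_iff_hasFDerivAt]
    refine ((hd y).hasFDerivAt.sub
      ((hasStrictFDerivAt_norm_sq y).hasFDerivAt.const_mul (σ / 2))).congr_fderiv ?_
    ext v
    simp
    ring
  have h := (strongConvexOn_iff_convex.mp hg).inner_gradient_sub_nonneg
    (fun y => (hgrad y).differentiableAt) a b
  rw [(hgrad a).gradient, (hgrad b).gradient, sub_sub_sub_comm, ← smul_sub, inner_sub_left,
    real_inner_smul_left, real_inner_self_eq_norm_sq] at h
  linarith

/-- The derivative of a strongly monotone operator is coercive. -/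
theorem le_inner_fderiv_of_stronglyMonotone {G : E → E} {c : ℝ}
    (hG : ∀ a b, c * ‖a - b‖ ^ 2 ≤ inner ℝ (G a - G b) (a - b)) {y : E}
    (hd : DifferentiableAt ℝ G y) (v : E) :
    c * ‖v‖ ^ 2 ≤ inner ℝ (fderiv ℝ G y v) v := by
  have hline : HasDerivAt (fun t : ℝ => y + t • v) v 0 := by
    simpa using ((hasDerivAt_id (0 : ℝ)).smul_const v).const_add y
  have hGline : HasDerivAt (fun t : ℝ => G (y + t • v)) (fderiv ℝ G y v) 0 :=
    HasFDerivAt.comp_hasDerivAt (0 : ℝ) (by simpa using hd.hasFDerivAt) hline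
  have hderiv : HasDerivAt (fun t : ℝ => inner ℝ (G (y + t • v)) v - t * (c * ‖v‖ ^ 2))
      (inner ℝ (fderiv ℝ G y v) v - c * ‖v‖ ^ 2) 0 := by
    refine ((hGline.inner ℝ (hasDerivAt_const (0 : ℝ) v)).sub
      ((hasDerivAt_id (0 : ℝ)).mul_const (c * ‖v‖ ^ 2))).congr_deriv ?_
    simp
  have hmono : Monotone fun t : ℝ => inner ℝ (G (y + t • v)) v - t * (c * ‖v‖ ^ 2) := by
    intro s t hst
    rcases hst.eq_or_lt with rfl | hlt
    · exact le_rfl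
    have h := hG (y + t • v) (y + s • v)
    rw [add_sub_add_left_eq_sub, ← sub_smul, norm_smul, mul_pow, Real.norm_eq_abs, sq_abs,
      real_inner_smul_right, inner_sub_left] at h
    have h' : 0 ≤ (t - s) * (inner ℝ (G (y + t • v)) v - inner ℝ (G (y + s • v)) v
        - (t - s) * (c * ‖v‖ ^ 2)) := by linarith
    have h'' := nonneg_of_mul_nonneg_right h' (sub_pos.mpr hlt)
    simp only
    linarith
  have h := hmono.deriv_nonneg (x := 0)
  rw [hderiv.deriv] at h
  linarith

/-- Coercivity of the derivative of the convex combination `ν • G + (1 - ν) • H` of a strongly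
monotone operator `G` and a monotone operator `H`. -/
theorem le_inner_fderiv_combination {G H : E → E} {σ : ℝ}
    (hG : ∀ a b, σ * ‖a - b‖ ^ 2 ≤ inner ℝ (G a - G b) (a - b))
    (hH : ∀ a b, 0 ≤ inner ℝ (H a - H b) (a - b)) {z : E}
    (hGd : DifferentiableAt ℝ G z) (hHd : DifferentiableAt ℝ H z)
    {ν : ℝ} (hν : 0 ≤ ν) (hν1 : ν ≤ 1) (w : E) :
    ν * σ * ‖w‖ ^ 2 ≤ inner ℝ ((ν • fderiv ℝ G z + (1 - ν) • fderiv ℝ H z) w) w := by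
  have h1 := mul_le_mul_of_nonneg_left (le_inner_fderiv_of_stronglyMonotone hG hGd w) hν
  have h2 : 0 ≤ inner ℝ (fderiv ℝ H z w) w := by
    simpa using le_inner_fderiv_of_stronglyMonotone (c := 0) (by simpa using hH) hHd w
  have h2' := mul_nonneg (sub_nonneg.mpr hν1) h2
  simp only [add_apply, smul_apply, inner_add_left, real_inner_smul_left]
  linarith

/-- Cauchy–Schwarz turns a coercivity estimate into a lower bound for norms. -/
theorem mul_norm_le_of_mul_sq_le_inner {c : ℝ} {u w : E}
    (h : c * ‖w‖ ^ 2 ≤ inner ℝ u w) : c * ‖w‖ ≤ ‖u‖ := by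
  rcases (norm_nonneg w).eq_or_lt with hw | hw
  · simp [← hw]
  · refine le_of_mul_le_mul_right ?_ hw
    calc c * ‖w‖ * ‖w‖ = c * ‖w‖ ^ 2 := by ring
      _ ≤ ‖u‖ * ‖w‖ := h.trans (real_inner_le_norm u w)

/-- A coercive endomorphism of a finite-dimensional space is invertible. -/
theorem ContinuousLinearMap.isInvertible_of_coercive [FiniteDimensional ℝ E] {A : E →L[ℝ] E}
    {c : ℝ} (hc : 0 < c) (hA : ∀ w, c * ‖w‖ ^ 2 ≤ inner ℝ (A w) w) : A.IsInvertible := by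
  have hinj : Function.Injective A.toLinearMap := by
    refine (injective_iff_map_eq_zero A.toLinearMap).mpr fun w hw => ?_
    have h := mul_norm_le_of_mul_sq_le_inner (hA w)
    rw [show A w = 0 from hw, norm_zero] at h
    exact norm_le_zero_iff.mp (nonpos_of_mul_nonpos_right h hc)
  refine ⟨(LinearEquiv.ofInjectiveEndo A.toLinearMap hinj).toContinuousLinearEquiv, ?_⟩
  ext w
  simp

/-- Perturbation bound for the zeros of the convex combinations `μ • G + (1 - μ) • H` of a strongly
monotone operator `G` and a monotone operator `H`. -/
theorem norm_sub_zeros_le {G H : E → E} {σ : ℝ}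
    (hG : ∀ a b, σ * ‖a - b‖ ^ 2 ≤ inner ℝ (G a - G b) (a - b))
    (hH : ∀ a b, 0 ≤ inner ℝ (H a - H b) (a - b))
    {μ μ' : ℝ} (hμ : μ ≤ 1 / 2) (hμ' : 0 < μ') (hμ'1 : μ' ≤ 1) {y y' : E}
    (hy : μ • G y + (1 - μ) • H y = 0) (hy' : μ' • G y' + (1 - μ') • H y' = 0) :
    μ' * σ * ‖y - y'‖ ≤ 2 * ‖G y‖ * |μ - μ'| := by
  have hpos : 0 < 1 - μ := by linarith
  have hHy : H y = -((μ / (1 - μ)) • G y) := by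
    have h : (1 - μ) • H y = -(μ • G y) := eq_neg_of_add_eq_zero_right hy
    rw [← inv_smul_smul₀ hpos.ne' (H y), h, smul_neg, smul_smul, div_eq_inv_mul]
  have hres : μ' • G y + (1 - μ') • H y = ((μ' - μ) / (1 - μ)) • G y := by
    rw [hHy, smul_neg, smul_smul, ← sub_eq_add_neg, ← sub_smul]
    congr 1
    field_simp
    ring
  have hmono : μ' * σ * ‖y - y'‖ ^ 2 ≤
      inner ℝ (μ' • G y + (1 - μ') • H y) (y - y') := by
    have heq : μ' • G y + (1 - μ') • H y =
        μ' • (G y - G y') + (1 - μ') • (H y - H y') := by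
      rw [smul_sub, smul_sub, sub_add_sub_comm, hy', sub_zero]
    rw [heq, inner_add_left, real_inner_smul_left, real_inner_smul_left]
    have h1 := mul_le_mul_of_nonneg_left (hG y y') hμ'.le
    have h2 := mul_nonneg (sub_nonneg.mpr hμ'1) (hH y y')
    linarith
  refine (mul_norm_le_of_mul_sq_le_inner hmono).trans ?_
  rw [hres, norm_smul, norm_div, Real.norm_eq_abs, Real.norm_eq_abs, abs_of_pos hpos,
    abs_sub_comm]
  have h : |μ - μ'| / (1 - μ) ≤ 2 * |μ - μ'| := by
    rw [div_le_iff₀ hpos]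
    nlinarith [abs_nonneg (μ - μ')]
  nlinarith [norm_nonneg (G y)]

/-- Perturbation bound, in the parameter `μ`, for the solution of the linear system
`(μ • DG + (1 - μ) • DH) v = G` at the zero of `μ • G + (1 - μ) • H`, where `G` is strongly
monotone and `H` is monotone. -/
theorem norm_sub_linearSystem_solutions_le {G H : E → E}
    (hGd : Differentiable ℝ G) (hHd : Differentiable ℝ H)
    {L₁ K₁ L₂ K₂ : ℝ≥0} (hGL : LipschitzWith L₁ G) (hHL : LipschitzWith K₁ H)
    (hDG : LipschitzWith L₂ (fderiv ℝ G)) (hDH : LipschitzWith K₂ (fderiv ℝ H))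
    {σ : ℝ} (hσ : 0 < σ)
    (hG : ∀ a b, σ * ‖a - b‖ ^ 2 ≤ inner ℝ (G a - G b) (a - b))
    (hH : ∀ a b, 0 ≤ inner ℝ (H a - H b) (a - b))
    {μ μ' : ℝ} (hμ0 : 0 < μ) (hμ : μ ≤ 1 / 2) (hμ' : 0 < μ') (hμμ' : μ' ≤ 2 * μ) {y y' v v' : E}
    (hy : μ • G y + (1 - μ) • H y = 0) (hy' : μ' • G y' + (1 - μ') • H y' = 0)
    (hv : (μ • fderiv ℝ G y + (1 - μ) • fderiv ℝ H y) v = G y)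
    (hv' : (μ' • fderiv ℝ G y' + (1 - μ') • fderiv ℝ H y') v' = G y') :
    ‖v - v'‖ ≤ (2 * (L₂ + K₂) / σ ^ 2 * ‖v‖ + 2 * (2 * L₁ + K₁) / σ ^ 2) * ‖G y‖ *
      (|μ - μ'| / μ' ^ 2) := by
  have hμ'1 : μ' ≤ 1 := by linarith
  have hcoer (ν : ℝ) (hν : 0 < ν) (hν1 : ν ≤ 1) (z w : E) : ν * σ * ‖w‖ ≤
      ‖(ν • fderiv ℝ G z + (1 - ν) • fderiv ℝ H z) w‖ :=
    mul_norm_le_of_mul_sq_le_inner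
      (le_inner_fderiv_combination hG hH (hGd z) (hHd z) hν.le hν1 w)
  have hyy := norm_sub_zeros_le hG hH hμ hμ' hμ'1 hy hy'
  have hvG : μ * σ * ‖v‖ ≤ ‖G y‖ := by
    simpa only [hv] using hcoer μ hμ0 (by linarith) y v
  have hdecomp : (μ' • fderiv ℝ G y' + (1 - μ') • fderiv ℝ H y') (v - v') =
      μ' • (fderiv ℝ G y' - fderiv ℝ G y) v + (1 - μ') • (fderiv ℝ H y' - fderiv ℝ H y) v
      + (μ' - μ) • (fderiv ℝ G y v - fderiv ℝ H y v) + (G y - G y') := by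
    rw [map_sub, hv', ← hv]
    simp only [add_apply, smul_apply, sub_apply]
    module
  have hDGv : ‖(fderiv ℝ G y' - fderiv ℝ G y) v‖ ≤ L₂ * ‖y - y'‖ * ‖v‖ :=
    (ContinuousLinearMap.le_opNorm _ _).trans <| by
      gcongr
      rw [norm_sub_rev y y']
      exact hDG.norm_sub_le y' y
  have hDHv : ‖(fderiv ℝ H y' - fderiv ℝ H y) v‖ ≤ K₂ * ‖y - y'‖ * ‖v‖ :=
    (ContinuousLinearMap.le_opNorm _ _).trans <| by
      gcongr
      rw [norm_sub_rev y y']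
      exact hDH.norm_sub_le y' y
  have hGv : ‖fderiv ℝ G y v‖ ≤ L₁ * ‖v‖ :=
    ContinuousLinearMap.le_of_opNorm_le _ (norm_fderiv_le_of_lipschitz ℝ hGL) v
  have hHv : ‖fderiv ℝ H y v‖ ≤ K₁ * ‖v‖ :=
    ContinuousLinearMap.le_of_opNorm_le _ (norm_fderiv_le_of_lipschitz ℝ hHL) v
  have hmain : μ' * σ * ‖v - v'‖ ≤ (L₂ + K₂) * ‖y - y'‖ * ‖v‖ +
      |μ - μ'| * ((L₁ + K₁) * ‖v‖) + L₁ * ‖y - y'‖ := by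
    refine (hcoer μ' hμ' hμ'1 y' (v - v')).trans ?_
    rw [hdecomp]
    have h1 : ‖μ' • (fderiv ℝ G y' - fderiv ℝ G y) v‖ ≤ L₂ * ‖y - y'‖ * ‖v‖ := by
      rw [norm_smul, Real.norm_of_nonneg hμ'.le]
      exact (mul_le_of_le_one_left (norm_nonneg _) hμ'1).trans hDGv
    have h2 : ‖(1 - μ') • (fderiv ℝ H y' - fderiv ℝ H y) v‖ ≤ K₂ * ‖y - y'‖ * ‖v‖ := by
      rw [norm_smul, Real.norm_of_nonneg (sub_nonneg.mpr hμ'1)]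
      exact (mul_le_of_le_one_left (norm_nonneg _) (by linarith)).trans hDHv
    have h3 : ‖(μ' - μ) • (fderiv ℝ G y v - fderiv ℝ H y v)‖ ≤
        |μ - μ'| * ((L₁ + K₁) * ‖v‖) := by
      rw [norm_smul, Real.norm_eq_abs, abs_sub_comm]
      gcongr
      exact (norm_sub_le _ _).trans (by linarith)
    have h4 := hGL.norm_sub_le y y'
    refine norm_add₄_le.trans ?_
    linarith
  have hvG' : μ' * σ * ‖v‖ ≤ 2 * ‖G y‖ := by
    nlinarith [mul_nonneg hσ.le (norm_nonneg v)]
  have hpos : 0 < μ' * σ := by positivity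
  have hbound : (μ' * σ) ^ 2 * ‖v - v'‖ ≤
      (2 * (L₂ + K₂) * ‖v‖ + 2 * (2 * L₁ + K₁)) * ‖G y‖ * |μ - μ'| :=
    calc (μ' * σ) ^ 2 * ‖v - v'‖ = μ' * σ * (μ' * σ * ‖v - v'‖) := by ring
      _ ≤ μ' * σ * ((L₂ + K₂) * ‖y - y'‖ * ‖v‖ +
          |μ - μ'| * ((L₁ + K₁) * ‖v‖) + L₁ * ‖y - y'‖) := by gcongr
      _ = ((L₂ + K₂) * ‖v‖ + L₁) * (μ' * σ * ‖y - y'‖) +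
          |μ - μ'| * (L₁ + K₁) * (μ' * σ * ‖v‖) := by ring
      _ ≤ ((L₂ + K₂) * ‖v‖ + L₁) * (2 * ‖G y‖ * |μ - μ'|) +
          |μ - μ'| * (L₁ + K₁) * (2 * ‖G y‖) := by gcongr
      _ = (2 * (L₂ + K₂) * ‖v‖ + 2 * (2 * L₁ + K₁)) * ‖G y‖ * |μ - μ'| := by ring
  calc ‖v - v'‖ ≤ (2 * (L₂ + K₂) * ‖v‖ + 2 * (2 * L₁ + K₁)) * ‖G y‖ * |μ - μ'| /
        (μ' * σ) ^ 2 := by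
        rw [le_div_iff₀ (by positivity)]
        linarith
    _ = _ := by
        field_simp

end MonotoneGradient

/-- The second-argument slices of a `C^k` function of two variables are `C^k`. -/
theorem ContDiff.slice_right {F : Eu n → Eu m → ℝ} {k : WithTop ℕ∞}
    (hF : ContDiff ℝ k (Function.uncurry F)) (x : Eu n) : ContDiff ℝ k (F x) :=
  hF.comp (contDiff_prodMk_right x)

/-- The partial gradient of a `C²` function is differentiable in the lower-level variable. -/
theorem differentiable_grady {F : Eu n → Eu m → ℝ}
    (hF : ContDiff ℝ 2 (Function.uncurry F)) (x : Eu n) : Differentiable ℝ (grady F x) := by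
  have h : Differentiable ℝ (fderiv ℝ (F x)) :=
    ((hF.slice_right x).fderiv_right (m := 1) (by norm_num)).differentiable (by norm_num)
  exact (InnerProductSpace.toDual ℝ (Eu m)).symm.differentiable.comp h

theorem grady_aggreg {F f : Eu n → Eu m → ℝ} {x : Eu n} (hF : Differentiable ℝ (F x))
    (hf : Differentiable ℝ (f x)) (μ : ℝ) :
    grady (aggreg μ F f) x = fun y => μ • grady F x y + (1 - μ) • grady f x y := by
  funext y
  refine HasGradientAt.gradient ?_
  rw [hasGradientAt_iff_hasFDerivAt, map_add, map_smul, map_smul]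
  exact ((hF y).hasGradientAt.hasFDerivAt.const_mul μ).add
    ((hf y).hasGradientAt.hasFDerivAt.const_mul (1 - μ))

theorem hessyy_aggreg {F f : Eu n → Eu m → ℝ} {x : Eu n} (hF : Differentiable ℝ (F x))
    (hf : Differentiable ℝ (f x)) (hF' : Differentiable ℝ (grady F x))
    (hf' : Differentiable ℝ (grady f x)) (μ : ℝ) (y : Eu m) :
    hessyy (aggreg μ F f) x y = μ • hessyy F x y + (1 - μ) • hessyy f x y := by
  change fderiv ℝ (grady (aggreg μ F f) x) y = _
  rw [grady_aggreg hF hf]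
  exact (((hF' y).hasFDerivAt.const_smul μ).add ((hf' y).hasFDerivAt.const_smul (1 - μ))).fderiv

/-- Lemma A.3 (ii): smoothness of `μ ↦ v*_μ(x)`. -/
theorem vstar_mu_smoothness {n m : ℕ}
    (F f : Eu n → Eu m → ℝ)
    (hF : ContDiff ℝ 2 (Function.uncurry F))
    (hf : ContDiff ℝ 2 (Function.uncurry f))
    (LFy2 Lfy2 LFyy2 Lfyy2 : ℝ≥0)
    (hLFy2 : ∀ x, LipschitzWith LFy2 fun y => grady F x y)
    (hLfy2 : ∀ x, LipschitzWith Lfy2 fun y => grady f x y)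
    (hLFyy2 : ∀ x, LipschitzWith LFyy2 fun y => hessyy F x y)
    (hLfyy2 : ∀ x, LipschitzWith Lfyy2 fun y => hessyy f x y)
    (σF : ℝ) (hσF : 0 < σF)
    (hFsc : ∀ x, StrongConvexOn univ σF (F x))
    (hfconv : ∀ x, ConvexOn ℝ univ (f x))
    (ystar : ℝ → Eu n → Eu m)
    (hmin : ∀ μ ∈ Ioc (0 : ℝ) 1, ∀ x y,
      aggreg μ F f x (ystar μ x) ≤ aggreg μ F f x y)
    (vstar : ℝ → Eu n → Eu m)
    (hvstar : ∀ μ x, vstar μ x =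
      (hessyy (aggreg μ F f) x (ystar μ x)).inverse (grady F x (ystar μ x)))
    (Cv1 Cv2 : ℝ)
    (hCv1 : Cv1 = 2 * (LFyy2 + Lfyy2) / σF ^ 2)
    (hCv2 : Cv2 = 2 * (2 * LFy2 + Lfy2) / σF ^ 2) :
    ∀ (μ μ' : ℝ), 0 < μ → μ ≤ 1 / 2 → 0 < μ' → μ' ≤ 2 * μ → ∀ x,
      ‖vstar μ x - vstar μ' x‖ ≤
        (Cv1 * ‖vstar μ x‖ + Cv2) * ‖grady F x (ystar μ x)‖ * (|μ - μ'| / μ' ^ 2) := by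
  intro μ μ' hμ0 hμ hμ' hμμ' x
  have hFd := (hF.slice_right x).differentiable (by norm_num)
  have hfd := (hf.slice_right x).differentiable (by norm_num)
  have hF' := differentiable_grady hF x
  have hf' := differentiable_grady hf x
  have hG := (hFsc x).le_inner_gradient_sub hFd
  have hH := (hfconv x).inner_gradient_sub_nonneg hfd
  have hzero (ν : ℝ) (hν : 0 < ν) (hν1 : ν ≤ 1) :
      ν • grady F x (ystar ν x) + (1 - ν) • grady f x (ystar ν x) = 0 := by
    have hloc : IsLocalMin (aggreg ν F f x) (ystar ν x) :=
      Eventually.of_forall (hmin ν ⟨hν, hν1⟩ x)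
    rw [← congrFun (grady_aggreg hFd hfd ν) (ystar ν x)]
    change gradient (aggreg ν F f x) (ystar ν x) = 0
    rw [gradient, hloc.fderiv_eq_zero, map_zero]
  have hsolve (ν : ℝ) (hν : 0 < ν) (hν1 : ν ≤ 1) :
      (ν • hessyy F x (ystar ν x) + (1 - ν) • hessyy f x (ystar ν x)) (vstar ν x) =
        grady F x (ystar ν x) := by
    rw [hvstar, ← hessyy_aggreg hFd hfd hF' hf']
    refine ContinuousLinearMap.IsInvertible.self_apply_inverse
      (ContinuousLinearMap.isInvertible_of_coercive (mul_pos hν hσF) fun w => ?_) _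
    rw [hessyy_aggreg hFd hfd hF' hf']
    exact le_inner_fderiv_combination hG hH (hF' _) (hf' _) hν.le hν1 w
  rw [hCv1, hCv2]
  exact norm_sub_linearSystem_solutions_le hF' hf' (hLFy2 x) (hLfy2 x) (hLFyy2 x) (hLfyy2 x)
    hσF hG hH hμ0 hμ hμ' hμμ' (hzero μ hμ0 (by linarith)) (hzero μ' hμ' (by linarith))
    (hsolve μ hμ0 (by linarith)) (hsolve μ' hμ' (by linarith))
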